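/- Let a, b, c be positive real numbers with b² − 4ac = 1, set Q(X,Y) = aX² + bXY + cY², and let w := (b+1)/(2c) and w' := (b−1)/(2c) (the two roots of Q(1,−x) = 0, satisfying 0 < w' < w). Let α, β ∈ ℝ∖ℤ. Then the limit of the rectangular partial sums lim_{(M,N)→(∞,∞)} Σ_{p=1}^{M} Σ_{q=0}^{N} e^{2πi(pα+qβ)} / Q(p,q) exists and equals 𝓕₂(w'; α, β) − 𝓕₂(w; α, β). -/

import Mathlib

open Complex MeasureTheory Filter Topology Set Asymptotics

noncomputable section

/-- `e2pi θ = e^{2πiθ}`. -/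
def e2pi (θ : ℝ) : ℂ := Complex.exp (2 * Real.pi * Complex.I * θ)

/-- Polylogarithm of integer order: `Li 0 z = z/(1-z)`, `Li 1 z = -Log(1-z)`,
`Li m z = ∑_{n≥1} z^n/n^m` for `m ≥ 2`. -/
def Li : ℕ → ℂ → ℂ
  | 0, z => z / (1 - z)
  | 1, z => -Complex.log (1 - z)
  | (m+2), z => ∑' n : ℕ, z ^ (n+1) / ((n+1 : ℕ) : ℂ) ^ (m+2)

/-- The higher Herglotz–Zagier–Novikov function
`𝓕_k(x; α, β) = ∫₀^∞ Li_{k-1}(e^{-xt} e^{2πiα}) / (1 - e^{-t} e^{2πiβ}) dt`. -/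
def HHZN (k : ℕ) (x : ℂ) (α β : ℝ) : ℂ :=
  ∫ t in Set.Ioi (0:ℝ),
    Li (k-1) (Complex.exp (-x * t) * e2pi α) / (1 - Complex.exp (-(t:ℂ)) * e2pi β)

/-- The indefinite binary quadratic form `Q(X,Y) = aX² + bXY + cY²`. -/
def Qform (a b c : ℝ) (X Y : ℝ) : ℝ := a * X ^ 2 + b * X * Y + c * Y ^ 2

theorem aux_e2pi_norm (θ : ℝ) : ‖e2pi θ‖ = 1 := by
  unfold e2pi
  rw [Complex.norm_exp]; simp

theorem aux_e2pi_ne (θ : ℝ) (h : ∀ n : ℤ, θ ≠ n) : e2pi θ ≠ 1 := by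
  unfold e2pi
  intro h1
  rw [Complex.exp_eq_one_iff] at h1
  obtain ⟨n, hn⟩ := h1
  apply h n
  have h2 : (2 * (Real.pi : ℂ) * Complex.I) ≠ 0 := Complex.two_pi_I_ne_zero
  rw [mul_comm (n : ℂ)] at hn
  have := mul_left_cancel₀ h2 hn
  exact_mod_cast this

theorem aux_delta (θ : ℝ) (h : ∀ n : ℤ, θ ≠ n) :
    ∃ δ : ℝ, 0 < δ ∧ ∀ r : ℝ, 0 ≤ r → r ≤ 1 → δ ≤ ‖1 - (r : ℂ) * e2pi θ‖ := by
  have hc : ContinuousOn (fun r : ℝ => ‖1 - (r : ℂ) * e2pi θ‖) (Set.Icc 0 1) := by fun_prop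
  obtain ⟨r0, hr0, hmin⟩ := isCompact_Icc.exists_isMinOn ⟨0, by simp⟩ hc
  refine ⟨‖1 - (r0 : ℂ) * e2pi θ‖, ?_, fun r h0 h1 => hmin ⟨h0, h1⟩⟩
  rw [norm_pos_iff]
  intro h0
  have h1 : (r0 : ℂ) * e2pi θ = 1 := (sub_eq_zero.mp h0).symm
  have h2 : ‖(r0 : ℂ) * e2pi θ‖ = 1 := by rw [h1]; simp
  rw [norm_mul, aux_e2pi_norm, mul_one, Complex.norm_real, Real.norm_of_nonneg hr0.1] at h2
  rw [h2] at h1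
  exact aux_e2pi_ne θ h (by simpa using h1)

theorem aux_geom (z : ℂ) (hz : ‖z‖ ≤ 1) (N : ℕ) :
    ‖1 - z‖ * ‖∑ q ∈ Finset.range N, z ^ q‖ ≤ 2 := by
  rw [← norm_mul, mul_neg_geom_sum]
  calc ‖1 - z ^ N‖ ≤ ‖(1 : ℂ)‖ + ‖z ^ N‖ := norm_sub_le _ _
    _ ≤ 1 + 1 := by
      rw [norm_pow]; simp only [norm_one]
      gcongr
      exact pow_le_one₀ (norm_nonneg _) hz
    _ = 2 := by norm_num

theorem aux_logsum (z : ℂ) (hz : ‖z‖ ≤ 1) (M : ℕ) :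
    ‖1 - z‖ * ‖∑ p ∈ Finset.range M, z ^ p / ((p : ℂ) + 1)‖ ≤ 2 := by
  have hpw : ∀ n : ℕ, ‖z ^ n‖ ≤ 1 := fun n => by
    rw [norm_pow]; exact pow_le_one₀ (norm_nonneg _) hz
  have key : ∀ M : ℕ, ‖(1 - z) * (∑ p ∈ Finset.range M, z ^ p / ((p : ℂ) + 1)) +
      z ^ M * ((1 / ((M : ℝ) + 1) : ℝ) : ℂ)‖ ≤ 2 - 1 / ((M : ℝ) + 1) := by
    intro M
    induction M with
    | zero => norm_num
    | succ M ih =>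
      have e : (1 - z) * (∑ p ∈ Finset.range (M + 1), z ^ p / ((p : ℂ) + 1)) +
          z ^ (M + 1) * ((1 / (((M + 1 : ℕ) : ℝ) + 1) : ℝ) : ℂ) =
          ((1 - z) * (∑ p ∈ Finset.range M, z ^ p / ((p : ℂ) + 1)) +
            z ^ M * ((1 / ((M : ℝ) + 1) : ℝ) : ℂ)) -
          z ^ (M + 1) * ((1 / ((M : ℝ) + 1) - 1 / (((M + 1 : ℕ) : ℝ) + 1) : ℝ) : ℂ) := by
        rw [Finset.sum_range_succ]
        push_cast
        ring
      rw [e]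
      have hd : 0 ≤ 1 / ((M : ℝ) + 1) - 1 / (((M + 1 : ℕ) : ℝ) + 1) := by
        rw [sub_nonneg]
        apply one_div_le_one_div_of_le (by positivity)
        push_cast; linarith
      refine (norm_sub_le _ _).trans ?_
      have h2 : ‖z ^ (M + 1) * ((1 / ((M : ℝ) + 1) - 1 / (((M + 1 : ℕ) : ℝ) + 1) : ℝ) : ℂ)‖
          ≤ 1 / ((M : ℝ) + 1) - 1 / (((M + 1 : ℕ) : ℝ) + 1) := by
        rw [norm_mul, Complex.norm_real, Real.norm_of_nonneg hd]
        exact mul_le_of_le_one_left hd (hpw _)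
      linarith
  have hk := key M
  rw [← norm_mul]
  have h3 : ‖z ^ M * ((1 / ((M : ℝ) + 1) : ℝ) : ℂ)‖ ≤ 1 / ((M : ℝ) + 1) := by
    rw [norm_mul, Complex.norm_real, Real.norm_of_nonneg (by positivity)]
    exact mul_le_of_le_one_left (by positivity) (hpw _)
  have h4 := norm_le_norm_add_norm_sub' ((1 - z) * (∑ p ∈ Finset.range M, z ^ p / ((p : ℂ) + 1)))
    ((1 - z) * (∑ p ∈ Finset.range M, z ^ p / ((p : ℂ) + 1)) +
      z ^ M * ((1 / ((M : ℝ) + 1) : ℝ) : ℂ))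
  rw [sub_add_cancel_left, norm_neg] at h4
  linarith

theorem aux_Icc (f : ℕ → ℂ) (M : ℕ) :
    ∑ p ∈ Finset.Icc 1 M, f p = ∑ p ∈ Finset.range M, f (p + 1) := by
  rw [Finset.sum_bij (fun p _ => p - 1) (t := Finset.range M) (g := fun p => f (p + 1))]
  · intro p hp; simp at hp ⊢; omega
  · intro p hp q hq h; simp at hp hq h; omega
  · intro q hq; exact ⟨q + 1, by simp at hq ⊢; omega, by simp⟩
  · intro p hp; simp at hp; congr 1; omega

theorem aux_e2pi_lin (α β : ℝ) (p q : ℕ) :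
    e2pi (p * α + q * β) = e2pi α ^ p * e2pi β ^ q := by
  unfold e2pi
  rw [← Complex.exp_nat_mul, ← Complex.exp_nat_mul, ← Complex.exp_add]
  congr 1
  push_cast
  ring

theorem aux_main (x : ℝ) (hx : 0 < x) (α β : ℝ)
    (hα : ∀ n : ℤ, α ≠ n) (hβ : ∀ n : ℤ, β ≠ n) :
    Tendsto
      (fun MN : ℕ × ℕ =>
        ∑ p ∈ Finset.range MN.1, ∑ q ∈ Finset.range (MN.2 + 1),
          e2pi (((p + 1 : ℕ) : ℝ) * α + q * β) / ((p : ℂ) + 1) *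
            (1 / ((q : ℂ) + ((p : ℂ) + 1) * x)))
      atTop (𝓝 (HHZN 2 (x : ℂ) α β)) := by
  obtain ⟨δ, hδ, hδα⟩ := aux_delta α hα
  obtain ⟨ε, hε, hεβ⟩ := aux_delta β hβ
  have hrep : ∀ MN : ℕ × ℕ,
      ∑ p ∈ Finset.range MN.1, ∑ q ∈ Finset.range (MN.2 + 1),
          e2pi (((p + 1 : ℕ) : ℝ) * α + q * β) / ((p : ℂ) + 1) *
            (1 / ((q : ℂ) + ((p : ℂ) + 1) * x)) =
      ∫ t in Set.Ioi (0:ℝ),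
        (∑ p ∈ Finset.range MN.1, (Complex.exp (-x * t) * e2pi α) ^ (p + 1) / ((p : ℂ) + 1)) *
        (∑ q ∈ Finset.range (MN.2 + 1), (Complex.exp (-(t:ℂ)) * e2pi β) ^ q) := by
    intro MN
    have hterm : ∀ (p q : ℕ) (t : ℝ),
        (Complex.exp (-x * t) * e2pi α) ^ (p + 1) / ((p : ℂ) + 1) *
          (Complex.exp (-(t:ℂ)) * e2pi β) ^ q =
        e2pi (((p + 1 : ℕ) : ℝ) * α + q * β) / ((p : ℂ) + 1) *
          Complex.exp (-((q : ℂ) + ((p : ℂ) + 1) * x) * t) := by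
      intro p q t
      have : Complex.exp (-((q : ℂ) + ((p : ℂ) + 1) * x) * t) =
          Complex.exp (-x * t) ^ (p + 1) * Complex.exp (-(t:ℂ)) ^ q := by
        rw [← Complex.exp_nat_mul, ← Complex.exp_nat_mul, ← Complex.exp_add]
        congr 1
        push_cast
        ring
      rw [this, aux_e2pi_lin, mul_pow, mul_pow]
      ring
    have hre : ∀ p q : ℕ, (-((q : ℂ) + ((p : ℂ) + 1) * x)).re < 0 := by
      intro p q
      simp
      nlinarith [mul_pos (by positivity : 0 < (p : ℝ) + 1) hx, (Nat.cast_nonneg q : (0:ℝ) ≤ q)]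
    simp_rw [Finset.sum_mul_sum, hterm]
    rw [integral_finsetSum]
    · refine Finset.sum_congr rfl fun p _ => ?_
      rw [integral_finsetSum]
      · refine Finset.sum_congr rfl fun q _ => ?_
        rw [integral_const_mul, integral_exp_mul_complex_Ioi (hre p q)]
        simp [neg_div, div_neg, -neg_add_rev]
      · intro q _
        exact (integrableOn_exp_mul_complex_Ioi (hre p q) 0).const_mul _
    · intro p _
      refine integrable_finsetSum _ fun q _ => ?_
      exact (integrableOn_exp_mul_complex_Ioi (hre p q) 0).const_mul _
  simp_rw [hrep]
  unfold HHZN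
  have hnz : ∀ t : ℝ, Complex.exp (-x * t) = ((Real.exp (-x * t) : ℝ) : ℂ) := by
    intro t; push_cast; rfl
  have hny : ∀ t : ℝ, Complex.exp (-(t : ℂ)) = ((Real.exp (-t) : ℝ) : ℂ) := by
    intro t; push_cast; rfl
  have hNz : ∀ t : ℝ, ‖Complex.exp (-x * t) * e2pi α‖ = Real.exp (-x * t) := by
    intro t
    rw [norm_mul, aux_e2pi_norm, hnz, Complex.norm_real, Real.norm_of_nonneg (Real.exp_pos _).le,
      mul_one]
  have hNy : ∀ t : ℝ, ‖Complex.exp (-(t : ℂ)) * e2pi β‖ = Real.exp (-t) := by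
    intro t
    rw [norm_mul, aux_e2pi_norm, hny, Complex.norm_real, Real.norm_of_nonneg (Real.exp_pos _).le,
      mul_one]
  refine tendsto_integral_filter_of_dominated_convergence
    (fun t => (2 / δ * (2 / ε)) * Real.exp (-x * t)) ?_ ?_ ?_ ?_
  · refine Eventually.of_forall fun MN => Continuous.aestronglyMeasurable ?_
    fun_prop
  · refine Eventually.of_forall fun MN => ?_
    refine (ae_restrict_mem measurableSet_Ioi).mono fun t ht => ?_
    have ht0 : (0:ℝ) < t := ht
    have hz1 : Real.exp (-x * t) ≤ 1 := Real.exp_le_one_iff.mpr (by nlinarith)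
    have hy1 : Real.exp (-t) ≤ 1 := Real.exp_le_one_iff.mpr (by linarith)
    have h1 := aux_logsum (Complex.exp (-x * t) * e2pi α) (by rw [hNz]; exact hz1) MN.1
    have h2 := aux_geom (Complex.exp (-(t:ℂ)) * e2pi β) (by rw [hNy]; exact hy1) (MN.2 + 1)
    have h3 := hδα _ (Real.exp_pos (-x * t)).le hz1
    have h4 := hεβ _ (Real.exp_pos (-t)).le hy1
    rw [← hnz] at h3
    rw [← hny] at h4
    have h5 : ‖∑ p ∈ Finset.range MN.1, (Complex.exp (-x * t) * e2pi α) ^ p / ((p : ℂ) + 1)‖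
        ≤ 2 / δ := by
      rw [le_div_iff₀ hδ, mul_comm]
      exact (mul_le_mul_of_nonneg_right h3 (norm_nonneg _)).trans h1
    have h6 : ‖∑ q ∈ Finset.range (MN.2 + 1), (Complex.exp (-(t:ℂ)) * e2pi β) ^ q‖ ≤ 2 / ε := by
      rw [le_div_iff₀ hε, mul_comm]
      exact (mul_le_mul_of_nonneg_right h4 (norm_nonneg _)).trans h2
    have h7 : ∑ p ∈ Finset.range MN.1, (Complex.exp (-x * t) * e2pi α) ^ (p + 1) / ((p : ℂ) + 1)
        = (Complex.exp (-x * t) * e2pi α) *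
          ∑ p ∈ Finset.range MN.1, (Complex.exp (-x * t) * e2pi α) ^ p / ((p : ℂ) + 1) := by
      rw [Finset.mul_sum]
      refine Finset.sum_congr rfl fun p _ => ?_
      rw [pow_succ]; ring
    rw [h7, norm_mul, norm_mul, hNz]
    calc _ ≤ Real.exp (-x * t) * (2 / δ) * (2 / ε) := by gcongr
      _ = _ := by ring
  · exact (exp_neg_integrableOn_Ioi 0 hx).const_mul _
  · refine (ae_restrict_mem measurableSet_Ioi).mono fun t ht => ?_
    have ht0 : (0:ℝ) < t := ht
    have hz1 : Real.exp (-x * t) < 1 := Real.exp_lt_one_iff.mpr (by nlinarith)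
    have hy1 : Real.exp (-t) < 1 := Real.exp_lt_one_iff.mpr (by linarith)
    have h1 := (Complex.hasSum_taylorSeries_neg_log'
      (z := Complex.exp (-x * t) * e2pi α) (by rw [hNz]; exact hz1)).tendsto_sum_nat
    have h2 := (hasSum_geometric_of_norm_lt_one
      (ξ := Complex.exp (-(t:ℂ)) * e2pi β) (by rw [hNy]; exact hy1)).tendsto_sum_nat
    have h2' := h2.comp (tendsto_add_atTop_nat 1)
    rw [← prod_atTop_atTop_eq]
    have := (h1.comp tendsto_fst).mul (h2'.comp (tendsto_snd (f := (atTop : Filter ℕ))))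
    simpa [Li, div_eq_mul_inv, Function.comp_def] using this

/-- The second Kronecker limit formula for Zagier's zeta function: for `a, b, c > 0` with
`b² - 4ac = 1`, roots `w = (b+1)/(2c) > w' = (b-1)/(2c) > 0` of `Q(1,-x) = 0`, and
`α, β ∈ ℝ∖ℤ`, the rectangular partial sums of `∑ e^{2πi(pα+qβ)}/Q(p,q)` converge to
`𝓕₂(w'; α, β) - 𝓕₂(w; α, β)`. -/
theorem second_kronecker_limit_formula (a b c : ℝ) (ha : 0 < a) (hb : 0 < b) (hc : 0 < c)
    (hdisc : b ^ 2 - 4 * a * c = 1) (α β : ℝ)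
    (hα : ∀ n : ℤ, α ≠ n) (hβ : ∀ n : ℤ, β ≠ n) :
    Tendsto
      (fun MN : ℕ × ℕ =>
        ∑ p ∈ Finset.Icc 1 MN.1, ∑ q ∈ Finset.range (MN.2 + 1),
          e2pi (p * α + q * β) / (Qform a b c p q : ℂ))
      atTop
      (𝓝 (HHZN 2 (((b - 1) / (2 * c) : ℝ) : ℂ) α β -
           HHZN 2 (((b + 1) / (2 * c) : ℝ) : ℂ) α β)) := by
  have hb1 : 1 < b := by nlinarith [mul_pos ha hc]
  have h1 := aux_main ((b - 1) / (2 * c)) (div_pos (by linarith) (by linarith)) α β hα hβ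
  have h2 := aux_main ((b + 1) / (2 * c)) (div_pos (by linarith) (by linarith)) α β hα hβ
  refine (h1.sub h2).congr fun MN => ?_
  rw [aux_Icc, ← Finset.sum_sub_distrib]
  refine Finset.sum_congr rfl fun p _ => ?_
  rw [← Finset.sum_sub_distrib]
  refine Finset.sum_congr rfl fun q _ => ?_
  rw [← mul_sub, div_mul_eq_mul_div, mul_div_assoc, div_eq_mul_inv (e2pi _)]
  congr 1
  have hp : (0:ℝ) < (p : ℝ) + 1 := by positivity
  have hq : (0:ℝ) ≤ (q : ℝ) := Nat.cast_nonneg q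
  have key : ∀ P q : ℝ, 0 < P → 0 ≤ q →
      (1 / (q + P * ((b - 1) / (2 * c))) - 1 / (q + P * ((b + 1) / (2 * c)))) / P =
      (Qform a b c P q)⁻¹ := by
    intro P q hP hq
    have hA : 0 < q + P * ((b - 1) / (2 * c)) := by
      have : 0 < (b - 1) / (2 * c) := div_pos (by linarith) (by linarith)
      positivity
    have hB : 0 < q + P * ((b + 1) / (2 * c)) := by
      have : 0 < (b + 1) / (2 * c) := div_pos (by linarith) (by linarith)
      positivity
    have hQ : Qform a b c P q =
        c * ((q + P * ((b - 1) / (2 * c))) * (q + P * ((b + 1) / (2 * c)))) := by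
      unfold Qform
      field_simp
      linear_combination (-P ^ 2) * hdisc
    have hdiff : (q + P * ((b + 1) / (2 * c))) - (q + P * ((b - 1) / (2 * c))) = P / c := by
      field_simp; ring
    rw [hQ, div_sub_div _ _ hA.ne' hB.ne', one_mul, mul_one, hdiff]
    field_simp
  have := key ((p : ℝ) + 1) q hp hq
  have h3 := congrArg (fun r : ℝ => (r : ℂ)) this
  push_cast at h3 ⊢
  exact h3

end
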